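/- Let (N, ∘_λ) be a commutative associative conformal algebra and let D : N → N be a derivation, i.e., a ℂ-linear map with D∂ = ∂D and D(a∘_λ b) = D(a)∘_λ b + a∘_λ D(b) for all a, b (D applied coefficientwise to polynomials). Define a∗_λ b = a∘_λ D(b). Then (N, ∗_λ) is a Novikov conformal algebra. -/

import Mathlib

/-!
We model a `ℂ[∂]`-module as a complex vector space `L` together with an
endomorphism `D` (the action of `∂`).  A `λ`-product (or `λ`-bracket) is a
`ℂ`-bilinear map `L → L → L[λ]`, where the polynomial `x ∘_λ y = Σₙ λⁿ • cₙ`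
is encoded by its finitely supported family of coefficients `ℕ →₀ L`.
Substitution of the variable `λ` by a complex scalar, or by an operator such
as `-∂-λ`, is given by `ev`; since `ℂ` is infinite, an identity of
polynomials in (several) variables `λ, μ, γ` with coefficients in a complex
vector space holds formally if and only if it holds for all complex values
of the variables, which is how all identities are stated below.
-/

namespace ConfFormal

variable {L : Type*} [AddCommGroup L] [Module ℂ L]

/-- Evaluation of a polynomial `p = Σₙ λⁿ • pₙ` with coefficients in `L`
(encoded as the family of its coefficients) at an endomorphism `T` of `L`
(for instance at a scalar `λ`, or at an operator such as `-∂-λ`). -/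
noncomputable def ev (T : Module.End ℂ L) (p : ℕ →₀ L) : L :=
  p.sum fun n x => (T ^ n) x

/-- `app m T x y` is `x ∘_T y` : the `λ`-product `x ∘_λ y` recorded by the
`ℂ`-bilinear coefficient map `m`, with the variable `λ` substituted by the
endomorphism `T`. -/
noncomputable def app (m : L →ₗ[ℂ] L →ₗ[ℂ] (ℕ →₀ L)) (T : Module.End ℂ L) (x y : L) : L :=
  ev T (m x y)

/-- The scalar `c` viewed as an endomorphism of `L`. -/
noncomputable def sc (c : ℂ) : Module.End ℂ L := c • (1 : Module.End ℂ L)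

/-- `(L, D, m)` is a conformal algebra: conformal sesquilinearity holds. -/
structure IsConfAlg (D : Module.End ℂ L) (m : L →ₗ[ℂ] L →ₗ[ℂ] (ℕ →₀ L)) : Prop where
  sesq_left : ∀ (x y : L) (l : ℂ), app m (sc l) (D x) y = -l • app m (sc l) x y
  sesq_right : ∀ (x y : L) (l : ℂ),
    app m (sc l) x (D y) = D (app m (sc l) x y) + l • app m (sc l) x y

/-- `(L, D, m)` is a commutative associative conformal algebra. -/
structure IsCommAssocConfAlg (D : Module.End ℂ L) (m : L →ₗ[ℂ] L →ₗ[ℂ] (ℕ →₀ L))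
    extends IsConfAlg D m : Prop where
  assoc : ∀ (x y z : L) (l u : ℂ),
    app m (sc l) x (app m (sc u) y z) = app m (sc (l + u)) (app m (sc l) x y) z
  comm : ∀ (x y : L) (l : ℂ), app m (sc l) x y = app m (-(D + sc l)) y x

/-- `(L, D, br)` is a Lie conformal algebra. -/
structure IsLieConfAlg (D : Module.End ℂ L) (br : L →ₗ[ℂ] L →ₗ[ℂ] (ℕ →₀ L)) : Prop where
  sesq_left : ∀ (x y : L) (l : ℂ), app br (sc l) (D x) y = -l • app br (sc l) x y
  skew : ∀ (x y : L) (l : ℂ), app br (sc l) x y = -app br (-(sc l + D)) y x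
  jacobi : ∀ (x y z : L) (l u : ℂ),
    app br (sc l) x (app br (sc u) y z) =
      app br (sc (l + u)) (app br (sc l) x y) z + app br (sc u) y (app br (sc l) x z)

/-- `(L, D, m, br)` is a transposed Poisson conformal algebra. -/
structure IsTPCA (D : Module.End ℂ L) (m br : L →ₗ[ℂ] L →ₗ[ℂ] (ℕ →₀ L)) : Prop where
  commAssoc : IsCommAssocConfAlg D m
  lie : IsLieConfAlg D br
  tLeibniz : ∀ (x y z : L) (l u : ℂ),
    (2 : ℂ) • app m (sc l) x (app br (sc u) y z) =
      app br (sc (l + u)) (app m (sc l) x y) z + app br (sc u) y (app m (sc l) x z)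


/-- `(L, D, st)` is a left-symmetric (pre-Lie) conformal algebra. -/
structure IsLeftSymConfAlg (D : Module.End ℂ L) (st : L →ₗ[ℂ] L →ₗ[ℂ] (ℕ →₀ L))
    extends IsConfAlg D st : Prop where
  leftSym : ∀ (x y z : L) (l u : ℂ),
    app st (sc (l + u)) (app st (sc l) x y) z - app st (sc l) x (app st (sc u) y z)
      = app st (sc (l + u)) (app st (sc u) y x) z - app st (sc u) y (app st (sc l) x z)

/-- `(L, D, st)` is a Novikov conformal algebra. -/
structure IsNovikovConfAlg (D : Module.End ℂ L) (st : L →ₗ[ℂ] L →ₗ[ℂ] (ℕ →₀ L))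
    extends IsLeftSymConfAlg D st : Prop where
  novikov : ∀ (x y z : L) (l u : ℂ),
    app st (sc (l + u)) (app st (sc l) x y) z = app st (-(sc u + D)) (app st (sc l) x z) y

/-- `Dd` is a derivation of the conformal algebra `(L, D, m)` : it commutes
with `∂` and satisfies the Leibniz rule for the `λ`-product. -/
structure IsConfDerivation (D : Module.End ℂ L) (m : L →ₗ[ℂ] L →ₗ[ℂ] (ℕ →₀ L))
    (Dd : L →ₗ[ℂ] L) : Prop where
  comm_D : ∀ x : L, Dd (D x) = D (Dd x)
  leibniz : ∀ (x y : L) (l : ℂ),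
    Dd (app m (sc l) x y) = app m (sc l) (Dd x) y + app m (sc l) x (Dd y)

lemma sc_pow_apply (l : ℂ) (n : ℕ) (x : L) : ((sc l : Module.End ℂ L) ^ n) x = l ^ n • x := by
  simp [sc, smul_pow]

lemma ev_sub (T : Module.End ℂ L) (p q : ℕ →₀ L) : ev T (p - q) = ev T p - ev T q :=
  Finsupp.sum_sub_index fun n a b => map_sub (T ^ n) a b

/-- A polynomial with coefficients in `L` is determined by its values at complex scalars. -/
lemma eq_of_forall_ev_sc_eq {p q : ℕ →₀ L} (h : ∀ l : ℂ, ev (sc l) p = ev (sc l) q) :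
    p = q := by
  rw [← sub_eq_zero]
  have h0 : ∀ l : ℂ, ev (sc l) (p - q) = 0 := fun l => by rw [ev_sub, h, sub_self]
  generalize p - q = r at h0
  ext n
  refine (Module.forall_dual_apply_eq_zero_iff ℂ (r n)).1 fun f => ?_
  have hP : (r.sum fun k x => Polynomial.monomial k (f x)) = 0 := by
    refine Polynomial.funext fun l => ?_
    have := congrArg f (h0 l)
    simpa [ev, Finsupp.sum, Polynomial.eval_finsetSum, sc_pow_apply, mul_comm] using this
  have hc := congrArg (fun P => Polynomial.coeff P n) hP
  simp only [Finsupp.sum, Polynomial.finsetSum_coeff, Polynomial.coeff_monomial,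
    Polynomial.coeff_zero, Finset.sum_ite_eq'] at hc
  by_cases hn : n ∈ r.support
  · simpa [hn] using hc
  · simp [Finsupp.notMem_support_iff.1 hn]

lemma app_sum_left (m : L →ₗ[ℂ] L →ₗ[ℂ] (ℕ →₀ L)) (T : Module.End ℂ L) {ι : Type*}
    (s : Finset ι) (f : ι → L) (z : L) :
    app m T (∑ i ∈ s, f i) z = ∑ i ∈ s, app m T (f i) z := by
  simp only [app, ev, map_sum, LinearMap.sum_apply]
  exact (Finsupp.sum_finsetSum_index (fun n => map_zero (T ^ n))
    fun n a b => map_add (T ^ n) a b).symm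

lemma app_add_right (m : L →ₗ[ℂ] L →ₗ[ℂ] (ℕ →₀ L)) (T : Module.End ℂ L) (x y z : L) :
    app m T x (y + z) = app m T x y + app m T x z := by
  simp only [app, ev, map_add]
  exact Finsupp.sum_add_index' (fun n => map_zero (T ^ n)) fun n a b => map_add (T ^ n) a b

lemma app_add_left (m : L →ₗ[ℂ] L →ₗ[ℂ] (ℕ →₀ L)) (T : Module.End ℂ L) (x y z : L) :
    app m T (x + y) z = app m T x z + app m T y z := by
  simp only [app, ev, map_add, LinearMap.add_apply]
  exact Finsupp.sum_add_index' (fun n => map_zero (T ^ n)) fun n a b => map_add (T ^ n) a b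

lemma app_smul_left (m : L →ₗ[ℂ] L →ₗ[ℂ] (ℕ →₀ L)) (T : Module.End ℂ L) (c : ℂ) (x z : L) :
    app m T (c • x) z = c • app m T x z := by
  simp only [app, ev, map_smul, LinearMap.smul_apply]
  rw [Finsupp.sum_smul_index' fun n => map_zero (T ^ n), Finsupp.smul_sum]
  simp

/-- On the left of a product with variable `l + u`, the operator `-(∂ + l)` acts as `u`. -/
lemma IsConfAlg.app_neg_add_sc_pow_left {D : Module.End ℂ L} {m : L →ₗ[ℂ] L →ₗ[ℂ] (ℕ →₀ L)}
    (hm : IsConfAlg D m) (l u : ℂ) (n : ℕ) (x z : L) :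
    app m (sc (l + u)) (((-(D + sc l) : Module.End ℂ L) ^ n) x) z = u ^ n • app m (sc (l + u)) x z := by
  induction n with
  | zero => simp
  | succ n ih =>
    rw [pow_succ', Module.End.mul_apply]
    generalize ((-(D + sc l) : Module.End ℂ L) ^ n) x = y at ih
    have hy : (-(D + sc l) : Module.End ℂ L) y = (-1 : ℂ) • D y + (-l) • y := by
      simp [sc]; abel
    rw [hy, app_add_left, app_smul_left, app_smul_left, hm.sesq_left, ih]
    module

lemma IsCommAssocConfAlg.left_comm {D : Module.End ℂ L} {m : L →ₗ[ℂ] L →ₗ[ℂ] (ℕ →₀ L)}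
    (hm : IsCommAssocConfAlg D m) (x y z : L) (l u : ℂ) :
    app m (sc l) x (app m (sc u) y z) = app m (sc u) y (app m (sc l) x z) := by
  rw [hm.assoc, hm.assoc, hm.comm x y l, add_comm u l, app.eq_1 m (-(D + sc l)),
    app.eq_1 m (sc u) y x, ev, ev, Finsupp.sum, Finsupp.sum, app_sum_left, app_sum_left]
  refine Finset.sum_congr rfl fun n _ => ?_
  rw [hm.app_neg_add_sc_pow_left, sc_pow_apply, app_smul_left]

/-- If `D` is a derivation of a commutative associative
conformal algebra `(N, ∘_λ)`, then `a∗_λ b = a∘_λ D(b)` defines a Novikov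
conformal algebra. -/
theorem derivation_novikov {L : Type*} [AddCommGroup L] [Module ℂ L]
    (D : Module.End ℂ L) (m : L →ₗ[ℂ] L →ₗ[ℂ] (ℕ →₀ L))
    (hm : IsCommAssocConfAlg D m)
    (Dd : L →ₗ[ℂ] L) (hDd : IsConfDerivation D m Dd)
    (st : L →ₗ[ℂ] L →ₗ[ℂ] (ℕ →₀ L))
    (hst : ∀ (a b : L) (l : ℂ), app st (sc l) a b = app m (sc l) a (Dd b)) :
    IsNovikovConfAlg D st := by
  have hst' : ∀ (a b : L) (T : Module.End ℂ L), app st T a b = app m T a (Dd b) := fun a b T =>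
    congrArg (ev T) (eq_of_forall_ev_sc_eq (hst a b))
  refine ⟨⟨⟨fun x y l => ?_, fun x y l => ?_⟩, fun x y z l u => ?_⟩, fun x y z l u => ?_⟩
  · rw [hst, hst, hm.sesq_left]
  · rw [hst, hst, hDd.comm_D, hm.sesq_right]
  · simp only [hst, hDd.leibniz, app_add_right]
    rw [← hm.assoc, add_comm l u, ← hm.assoc, hm.left_comm x y (Dd (Dd z))]
    abel
  · simp only [hst']
    rw [add_comm (sc u) D, ← hm.comm, ← hm.assoc, hm.left_comm]

end ConfFormal
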